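/- arXiv:2307.14905 — 4 statements merged into one kernel-verified Lean document; each statement's English description precedes it below -/
import Mathlib

section
/- Let θ : ℝ → ℝ be differentiable at 0 with θ(0) = 0 and derivative θ'(0). For t > 0 let I_t be the 4×4 real matrix equal to the identity except that its lower-right 2×2 block (rows and columns indexed 2 and 3) is [[cos θ(t), sin θ(t)], [−sin θ(t), cos θ(t)]]. Then, as t → 0⁺, the conjugated matrices τ_t · I_t · τ_t⁻¹ converge to the 4×4 matrix equal to the identity except that its (3,2) entry is −θ'(0). -/
open Matrix Filter Topology Real

/-- The projective rescaling `τ_t = diag(1,1,1,1/|t|)`. -/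
noncomputable def tauRescale (t : ℝ) : Matrix (Fin 4) (Fin 4) ℝ :=
  Matrix.diagonal ![1, 1, 1, 1 / |t|]

theorem tauRescale_inv {t : ℝ} (ht : 0 < t) :
    (tauRescale t)⁻¹ = Matrix.diagonal ![1, 1, 1, t] := by
  refine Matrix.inv_eq_right_inv ?_
  rw [tauRescale, Matrix.diagonal_mul_diagonal, ← Matrix.diagonal_one]
  congr 1
  funext i
  fin_cases i <;> simp [abs_of_pos ht, ht.ne']

/-- Conjugation by `τ_t` multiplies the `(2,3)` entry by `t` and the `(3,2)` entry by `t⁻¹`. -/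
theorem tauRescale_conj_block {t : ℝ} (ht : 0 < t) (a b c d : ℝ) :
    tauRescale t * !![1, 0, 0, 0; 0, 1, 0, 0; 0, 0, a, b; 0, 0, c, d] * (tauRescale t)⁻¹ =
      !![1, 0, 0, 0; 0, 1, 0, 0; 0, 0, a, b * t; 0, 0, t⁻¹ * c, d] := by
  rw [tauRescale_inv ht, tauRescale]
  ext i j
  rw [Matrix.mul_diagonal, Matrix.diagonal_mul]
  fin_cases i <;> fin_cases j <;> simp [abs_of_pos ht]
  field_simp

/-- As `t → 0⁺`, the rescaled hyperbolic rotations `τ_t I_t τ_t⁻¹` of angle `θ t` about the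
geodesic `x₂ = x₃ = 0` converge to the half-pipe rotation of angle `θ'(0)`. -/
theorem rescaled_hyperbolic_rotation_tendsto_halfpipe_rotation
    (θ : ℝ → ℝ) (θ'₀ : ℝ) (hθ : HasDerivAt θ θ'₀ 0) (hθ0 : θ 0 = 0) :
    Tendsto
      (fun t : ℝ =>
        tauRescale t *
          !![1, 0, 0, 0;
             0, 1, 0, 0;
             0, 0, Real.cos (θ t), Real.sin (θ t);
             0, 0, -Real.sin (θ t), Real.cos (θ t)] *
        (tauRescale t)⁻¹)
      (nhdsWithin 0 (Set.Ioi 0))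
      (nhds !![1, 0, 0, 0;
               0, 1, 0, 0;
               0, 0, 1, 0;
               0, 0, -θ'₀, 1]) := by
  have hcos : Tendsto (fun t => Real.cos (θ t)) (𝓝[>] 0) (𝓝 1) := by
    simpa [hθ0] using hθ.cos.continuousAt.tendsto.mono_left nhdsWithin_le_nhds
  have hsin : Tendsto (fun t => Real.sin (θ t) * t) (𝓝[>] 0) (𝓝 0) := by
    simpa [Pi.mul_def] using
      (hθ.sin.continuousAt.mul continuousAt_id).tendsto.mono_left nhdsWithin_le_nhds
  have hslope : Tendsto (fun t => t⁻¹ * -Real.sin (θ t)) (𝓝[>] 0) (𝓝 (-θ'₀)) := by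
    simpa [hθ0] using hθ.sin.neg.tendsto_slope_zero_right
  have hlim : Tendsto
      (fun t : ℝ => !![1, 0, 0, 0;
                       0, 1, 0, 0;
                       0, 0, Real.cos (θ t), Real.sin (θ t) * t;
                       0, 0, t⁻¹ * -Real.sin (θ t), Real.cos (θ t)])
      (𝓝[>] 0)
      (𝓝 !![1, 0, 0, 0; 0, 1, 0, 0; 0, 0, 1, 0; 0, 0, -θ'₀, 1]) := by
    refine tendsto_pi_nhds.2 fun i => tendsto_pi_nhds.2 fun j => ?_
    fin_cases i <;> fin_cases j <;>
      first
        | exact tendsto_const_nhds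
        | exact hcos
        | exact hsin
        | exact hslope
  refine hlim.congr' ?_
  filter_upwards [self_mem_nhdsWithin] with t ht
  exact (tauRescale_conj_block ht _ _ _ _).symm
end

section
/- Let d : ℝ → ℝ be such that d(t)/t → c as t → 0⁺. For t > 0 let B_t be the 4×4 real matrix equal to the identity except that its entries in rows/columns 0 and 3 form the block (0,0) = (3,3) = cosh d(t) and (0,3) = (3,0) = −sinh d(t). Then τ_t · B_t · τ_t⁻¹ converges, as t → 0⁺, to the 4×4 matrix equal to the identity except that its (3,0) entry is −c. -/
open Matrix Filter Topology Real

/-- If `u → 0` and `u / v → c`, then `sinh u / v → c`. -/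
theorem Filter.Tendsto.sinh_div {α : Type*} {l : Filter α} {u v : α → ℝ} {c : ℝ}
    (hu : Tendsto u l (𝓝 0)) (h : Tendsto (fun x => u x / v x) l (𝓝 c)) :
    Tendsto (fun x => Real.sinh (u x) / v x) l (𝓝 c) := by
  have hs : Tendsto (fun x => dslope Real.sinh 0 (u x)) l (𝓝 1) := by
    have hc : ContinuousAt (dslope Real.sinh 0) 0 :=
      continuousAt_dslope_same.2 Real.differentiable_sinh.differentiableAt
    have := hc.tendsto.comp hu
    simpa [Function.comp_def] using this
  have hm := hs.mul h
  rw [one_mul] at hm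
  refine hm.congr fun x => ?_
  have := sub_smul_dslope Real.sinh 0 (u x)
  simp only [sub_zero, smul_eq_mul, Real.sinh_zero] at this
  rw [← this]
  ring

/-- The rescaled conjugates of the hyperbolic translations of length `d t` along the geodesic
`x₁ = x₂ = 0` of `H³` converge, as `t → 0⁺` with `d t / t → c`, to a half-pipe isometry. -/
theorem rescaled_hyperbolic_translation_tendsto_halfpipe_isometry
    (d : ℝ → ℝ) (c : ℝ)
    (hd : Tendsto (fun t : ℝ => d t / t) (nhdsWithin 0 (Set.Ioi 0)) (nhds c)) :
    Tendsto
      (fun t : ℝ =>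
        tauRescale t *
          !![Real.cosh (d t), 0, 0, -Real.sinh (d t);
             0, 1, 0, 0;
             0, 0, 1, 0;
             -Real.sinh (d t), 0, 0, Real.cosh (d t)] *
        (tauRescale t)⁻¹)
      (nhdsWithin 0 (Set.Ioi 0))
      (nhds !![1, 0, 0, 0;
               0, 1, 0, 0;
               0, 0, 1, 0;
               -c, 0, 0, 1]) := by
  have ht : Tendsto (fun t : ℝ => t) (𝓝[>] 0) (𝓝 0) := nhdsWithin_le_nhds
  have hpos : ∀ᶠ t : ℝ in 𝓝[>] 0, 0 < t := eventually_mem_nhdsWithin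
  have hd0 : Tendsto d (𝓝[>] 0) (𝓝 0) := by
    have h := hd.mul ht
    rw [mul_zero] at h
    refine h.congr' ?_
    filter_upwards [hpos] with t ht0
    exact div_mul_cancel₀ _ ht0.ne'
  have hcosh : Tendsto (fun t => Real.cosh (d t)) (𝓝[>] 0) (𝓝 1) := by
    simpa [Function.comp_def] using (Real.continuous_cosh.tendsto 0).comp hd0
  have hsinh : Tendsto (fun t => -Real.sinh (d t) * t) (𝓝[>] 0) (𝓝 0) := by
    simpa [Function.comp_def] using (((Real.continuous_sinh.tendsto 0).comp hd0).mul ht).neg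
  have hdiv : Tendsto (fun t => -(Real.sinh (d t) / t)) (𝓝[>] 0) (𝓝 (-c)) :=
    (hd0.sinh_div hd).neg
  have key : Tendsto
      (fun t : ℝ => !![Real.cosh (d t), 0, 0, -Real.sinh (d t) * t;
                       0, 1, 0, 0;
                       0, 0, 1, 0;
                       -(Real.sinh (d t) / t), 0, 0, Real.cosh (d t)])
      (𝓝[>] 0)
      (𝓝 !![1, 0, 0, 0; 0, 1, 0, 0; 0, 0, 1, 0; -c, 0, 0, 1]) := by
    refine tendsto_pi_nhds.2 fun i => tendsto_pi_nhds.2 fun j => ?_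
    fin_cases i <;> fin_cases j <;>
      first
        | exact tendsto_const_nhds
        | exact hcosh
        | exact hsinh
        | exact hdiv
  refine key.congr' ?_
  filter_upwards [hpos] with t ht0
  rw [tauRescale_inv ht0, tauRescale]
  ext i j
  rw [Matrix.mul_diagonal, Matrix.diagonal_mul]
  fin_cases i <;> fin_cases j <;> simp [abs_of_pos ht0] <;> field_simp
end

section
/- Let D be the closed unit ball and S the unit circle in ℝ², and let ψ : ℝ² → ℝ be continuous on D and concave on D. Assume that for every z₀ in the open unit ball there exists an affine map a : ℝ² → ℝ such that ψ(z) ≤ a(z) for all z ∈ D, a(z₀) = ψ(z₀), and the set {z ∈ D : a(z) = ψ(z)} is contained in the convex hull of {z ∈ S : a(z) = ψ(z)}. Then for every z₀ in the open unit ball, ψ(z₀) = inf { a(z₀) : a : ℝ² → ℝ affine and ψ(w) ≤ a(w) for all w ∈ S }. -/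
open Metric

/-- If a concave function `ψ` on the closed unit disk is, at every interior point, supported by
an affine map whose contact set with `ψ` is contained in the convex hull of its boundary
contact set, then on the interior `ψ` coincides with the infimum of the affine maps dominating
`ψ` on the boundary circle. -/
theorem pleated_concave_eq_inf_affine
    (ψ : EuclideanSpace ℝ (Fin 2) → ℝ)
    (hcont : ContinuousOn ψ (closedBall 0 1))
    (hconc : ConcaveOn ℝ (closedBall 0 1) ψ)
    (hsupp : ∀ z₀ ∈ ball (0 : EuclideanSpace ℝ (Fin 2)) 1,
      ∃ a : EuclideanSpace ℝ (Fin 2) →ᵃ[ℝ] ℝ,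
        (∀ z ∈ closedBall (0 : EuclideanSpace ℝ (Fin 2)) 1, ψ z ≤ a z) ∧
        a z₀ = ψ z₀ ∧
        {z ∈ closedBall (0 : EuclideanSpace ℝ (Fin 2)) 1 | a z = ψ z} ⊆
          convexHull ℝ {z ∈ sphere (0 : EuclideanSpace ℝ (Fin 2)) 1 | a z = ψ z}) :
    ∀ z₀ ∈ ball (0 : EuclideanSpace ℝ (Fin 2)) 1,
      ψ z₀ = sInf {r : ℝ | ∃ a : EuclideanSpace ℝ (Fin 2) →ᵃ[ℝ] ℝ,
        (∀ w ∈ sphere (0 : EuclideanSpace ℝ (Fin 2)) 1, ψ w ≤ a w) ∧ r = a z₀} := by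
  intro z₀ hz₀
  obtain ⟨a, ha, haz, hsub⟩ := hsupp z₀ hz₀
  symm
  apply IsLeast.csInf_eq
  refine ⟨⟨a, fun w hw => ha w (sphere_subset_closedBall hw), haz.symm⟩, ?_⟩
  rintro r ⟨b, hb, rfl⟩
  have hconv : Convex ℝ ((b - a) ⁻¹' Set.Ici 0) := (convex_Ici 0).affine_preimage (b - a)
  have hcontact : {z ∈ sphere (0 : EuclideanSpace ℝ (Fin 2)) 1 | a z = ψ z} ⊆
      (b - a) ⁻¹' Set.Ici 0 := by
    rintro w ⟨hw, haw⟩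
    simpa [haw] using hb w hw
  have hz := convexHull_min hcontact hconv (hsub ⟨ball_subset_closedBall hz₀, haz⟩)
  simpa [haz] using hz
end

section
/- Define ω : ℝ² → ℝ by ω(x) = −√(1 − ‖x‖²) (where ‖·‖ is the Euclidean norm). Let φ : ℝ² → ℝ and let C > 0 be such that φ + C·ω is convex on the open unit ball of ℝ² and φ − C·ω is concave on the open unit ball of ℝ². Then the restriction of φ to the open unit ball admits a continuous extension to the closed unit ball: there exists Φ : ℝ² → ℝ, continuous on the closed unit ball, with Φ(x) = φ(x) for all x in the open unit ball. -/
open Metric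

/-- A convex function on the open unit ball of a finite-dimensional space is bounded below. -/
theorem ConvexOn.exists_le_of_ball {E : Type*} [NormedAddCommGroup E] [NormedSpace ℝ E]
    [FiniteDimensional ℝ E] {f : E → ℝ} (hf : ConvexOn ℝ (ball (0 : E) 1) f) :
    ∃ m, ∀ x ∈ ball (0 : E) 1, m ≤ f x := by
  have hsub : closedBall (0 : E) (1 / 2) ⊆ ball 0 1 := closedBall_subset_ball (by norm_num)
  obtain ⟨K, hK⟩ := (isCompact_closedBall (0 : E) (1 / 2)).bddAbove_image
    ((hf.continuousOn isOpen_ball).mono hsub)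
  refine ⟨3 * f 0 - 2 * K, fun x hx => ?_⟩
  have hx1 : ‖x‖ < 1 := by simpa using hx
  have hy : -((1 / 2 : ℝ) • x) ∈ closedBall (0 : E) (1 / 2) := by
    rw [mem_closedBall_zero_iff, norm_neg, norm_smul]
    norm_num
    linarith
  have hfy : f (-((1 / 2 : ℝ) • x)) ≤ K := hK (Set.mem_image_of_mem f hy)
  have h := hf.2 hx (hsub hy) (show (0 : ℝ) ≤ 1 / 3 by norm_num)
    (show (0 : ℝ) ≤ 2 / 3 by norm_num) (by norm_num)
  have h0 : (1 / 3 : ℝ) • x + (2 / 3 : ℝ) • (-((1 / 2 : ℝ) • x)) = 0 := by module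
  rw [h0, smul_eq_mul, smul_eq_mul] at h
  linarith

/-- A bounded function on the unit ball that becomes convex after adding a multiple of the lower
hemisphere increases under radial contraction by at most a uniformly small amount. -/
theorem le_add_of_convexOn_add_hemisphere {E : Type*} [NormedAddCommGroup E] [NormedSpace ℝ E]
    {φ : E → ℝ} {C M r : ℝ} (hC : 0 ≤ C)
    (hconv : ConvexOn ℝ (ball (0 : E) 1) (fun x => φ x + C * (-√(1 - ‖x‖ ^ 2))))
    (hM : ∀ x ∈ ball (0 : E) 1, |φ x| ≤ M) (hr0 : 0 ≤ r) (hr1 : r ≤ 1)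
    {x : E} (hx : x ∈ ball (0 : E) 1) :
    φ (r • x) ≤ φ x + (2 * M * (1 - r) + C * √(1 - r ^ 2)) := by
  have h0 : (0 : E) ∈ ball (0 : E) 1 := mem_ball_self one_pos
  have hx1 : ‖x‖ < 1 := by simpa using hx
  have h := hconv.2 hx h0 hr0 (sub_nonneg.2 hr1) (by ring)
  simp only [smul_zero, add_zero, smul_eq_mul, norm_smul, Real.norm_eq_abs, abs_of_nonneg hr0,
    norm_zero] at h
  have hsqrt : √(1 - (r * ‖x‖) ^ 2) ≤ √(1 - r ^ 2) + r * √(1 - ‖x‖ ^ 2) := by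
    have hx2 : 0 ≤ 1 - ‖x‖ ^ 2 := by nlinarith [norm_nonneg x]
    have hr2 : 0 ≤ 1 - r ^ 2 := by nlinarith
    apply Real.sqrt_le_iff.2 ⟨by positivity, ?_⟩
    nlinarith [Real.sq_sqrt hx2, Real.sq_sqrt hr2,
      mul_nonneg (mul_nonneg hr0 (Real.sqrt_nonneg (1 - ‖x‖ ^ 2))) (Real.sqrt_nonneg (1 - r ^ 2))]
  have hC' := mul_le_mul_of_nonneg_left hsqrt hC
  have hφ0 := (abs_le.1 (hM 0 h0)).2
  have hφx := (abs_le.1 (hM x hx)).1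
  have hdiff := mul_le_mul_of_nonneg_left (show φ 0 - φ x ≤ 2 * M by linarith) (sub_nonneg.2 hr1)
  norm_num at h
  nlinarith [mul_nonneg hC (sub_nonneg.2 hr1)]

open Filter Topology in
/-- A function on the unit ball that is uniformly approximated by its radial contractions and
continuous on the open ball is uniformly continuous there. -/
theorem uniformContinuousOn_ball_of_radial_approx {E : Type*} [NormedAddCommGroup E]
    [NormedSpace ℝ E] [ProperSpace E] {φ : E → ℝ} (hφ : ContinuousOn φ (ball (0 : E) 1))
    {δ : ℝ → ℝ} (hδ : Tendsto δ (𝓝[<] 1) (𝓝 0))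
    (happrox : ∀ r ∈ Set.Ioo (0 : ℝ) 1, ∀ x ∈ ball (0 : E) 1, |φ (r • x) - φ x| ≤ δ r) :
    UniformContinuousOn φ (ball (0 : E) 1) := by
  rw [Metric.uniformContinuousOn_iff]
  intro ε hε
  obtain ⟨r, hrδ, hr⟩ := ((hδ.eventually_lt_const (show (0 : ℝ) < ε / 3 by positivity)).and
    (Ioo_mem_nhdsLT (zero_lt_one' ℝ))).exists
  have hmaps : Set.MapsTo (fun x : E => r • x) (closedBall 0 1) (ball 0 1) := by
    intro x hx
    rw [mem_closedBall_zero_iff] at hx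
    rw [mem_ball_zero_iff, norm_smul, Real.norm_eq_abs, abs_of_pos hr.1]
    nlinarith [hr.1, hr.2]
  have huc : UniformContinuousOn (fun x : E => φ (r • x)) (closedBall 0 1) :=
    (isCompact_closedBall (0 : E) 1).uniformContinuousOn_of_continuous
      (hφ.comp (continuous_const_smul r).continuousOn hmaps)
  obtain ⟨d, hd, H⟩ := Metric.uniformContinuousOn_iff.1 huc (ε / 3) (by positivity)
  refine ⟨d, hd, fun x hx y hy hxy => ?_⟩
  have h := H x (ball_subset_closedBall hx) y (ball_subset_closedBall hy) hxy
  rw [Real.dist_eq, abs_lt] at h ⊢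
  have hx' := abs_le.1 (happrox r hr x hx)
  have hy' := abs_le.1 (happrox r hr y hy)
  constructor <;> linarith [h.1, h.2, hx'.1, hx'.2, hy'.1, hy'.2]

open Filter Topology in
/-- A uniformly continuous function on a set extends continuously to the closure. -/
theorem UniformContinuousOn.exists_continuousOn_closure {X Y : Type*} [UniformSpace X]
    [UniformSpace Y] [CompleteSpace Y] [T3Space Y] {f : X → Y} {s : Set X}
    (hf : UniformContinuousOn f s) :
    ∃ g : X → Y, ContinuousOn g (closure s) ∧ ∀ x ∈ s, g x = f x := by
  refine ⟨extendFrom s f, continuousOn_extendFrom subset_rfl fun x hx => ?_, fun x hx =>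
    extendFrom_eq (subset_closure hx) (hf.continuousOn x hx)⟩
  have hne : (𝓝[s] x).NeBot := mem_closure_iff_nhdsWithin_neBot.1 hx
  refine cauchy_map_iff_exists_tendsto.1 (cauchy_map_iff.2 ⟨hne, ?_⟩)
  refine Tendsto.mono_left hf (le_inf ?_ ?_)
  · exact (Filter.prod_mono nhdsWithin_le_nhds nhdsWithin_le_nhds).trans (cauchy_nhds (a := x)).2
  · exact Filter.le_principal_iff.2 (Filter.prod_mem_prod self_mem_nhdsWithin self_mem_nhdsWithin)

/-- If `φ + C·ω` is convex and `φ − C·ω` is concave on the open unit disk, where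
`ω x = −√(1 − ‖x‖²)`, then `φ` extends continuously from the open unit disk to the closed
unit disk. -/
theorem extends_to_closed_disk_of_convex_concave
    (φ : EuclideanSpace ℝ (Fin 2) → ℝ) (C : ℝ) (hC : 0 < C)
    (hconv : ConvexOn ℝ (ball (0 : EuclideanSpace ℝ (Fin 2)) 1)
      (fun x => φ x + C * (-Real.sqrt (1 - ‖x‖ ^ 2))))
    (hconc : ConcaveOn ℝ (ball (0 : EuclideanSpace ℝ (Fin 2)) 1)
      (fun x => φ x - C * (-Real.sqrt (1 - ‖x‖ ^ 2)))) :
    ∃ Φ : EuclideanSpace ℝ (Fin 2) → ℝ,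
      ContinuousOn Φ (closedBall 0 1) ∧
      ∀ x ∈ ball (0 : EuclideanSpace ℝ (Fin 2)) 1, Φ x = φ x := by
  have hω : Continuous fun x : EuclideanSpace ℝ (Fin 2) => C * (-√(1 - ‖x‖ ^ 2)) := by fun_prop
  have hω0 (x : EuclideanSpace ℝ (Fin 2)) : C * (-√(1 - ‖x‖ ^ 2)) ≤ 0 :=
    mul_nonpos_of_nonneg_of_nonpos hC.le (neg_nonpos.2 (Real.sqrt_nonneg _))
  have hconv' : ConvexOn ℝ (ball (0 : EuclideanSpace ℝ (Fin 2)) 1)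
      (fun x => -φ x + C * (-√(1 - ‖x‖ ^ 2))) :=
    hconc.neg.congr fun x _ => by simp only [Pi.neg_apply]; ring
  obtain ⟨m, hm⟩ := hconv.exists_le_of_ball
  obtain ⟨m', hm'⟩ := hconv'.exists_le_of_ball
  have hM : ∀ x ∈ ball (0 : EuclideanSpace ℝ (Fin 2)) 1, |φ x| ≤ max (-m) (-m') := fun x hx =>
    abs_le.2 ⟨by linarith [hm x hx, hω0 x, le_max_left (-m) (-m')],
      by linarith [hm' x hx, hω0 x, le_max_right (-m) (-m')]⟩
  have hφ : ContinuousOn φ (ball 0 1) :=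
    ((hconv.continuousOn isOpen_ball).sub hω.continuousOn).congr fun x _ => by simp
  have hδ : Filter.Tendsto (fun r : ℝ => 2 * max (-m) (-m') * (1 - r) + C * √(1 - r ^ 2))
      (nhdsWithin 1 (Set.Iio 1)) (nhds 0) := by
    have hcont : Continuous fun r : ℝ => 2 * max (-m) (-m') * (1 - r) + C * √(1 - r ^ 2) := by
      fun_prop
    exact (hcont.tendsto' 1 0 (by simp)).mono_left nhdsWithin_le_nhds
  have huc := uniformContinuousOn_ball_of_radial_approx hφ hδ fun r hr x hx => by
    have h₁ := le_add_of_convexOn_add_hemisphere hC.le hconv hM hr.1.le hr.2.le hx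
    have h₂ := le_add_of_convexOn_add_hemisphere hC.le hconv'
      (fun x hx => (abs_neg (φ x)).trans_le (hM x hx)) hr.1.le hr.2.le hx
    exact abs_le.2 ⟨by linarith, by linarith⟩
  simpa only [closure_ball (0 : EuclideanSpace ℝ (Fin 2)) one_ne_zero] using
    huc.exists_continuousOn_closure
end
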